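/- Let P be a polynomial ring over a field of positive characteristic p, q = p^e, and let C ⊂ P be an ideal generated by a regular sequence f_1, …, f_c. Then C^{[q]} : C = (y) + C^{[q]}, where y = (f_1·f_2·⋯·f_c)^{q−1}. -/

import Mathlib

open Finset CategoryTheory

section Prelim
variable {k : Type} [Field k] {R : Type} [CommRing R] [Algebra k R]

/-- The irrelevant maximal ideal `m = ⊕_{i>0} R_i` of a graded algebra with pieces `𝒜`. -/
def irrel (𝒜 : ℕ → Submodule k R) : Ideal R :=
  Ideal.span {x : R | ∃ i, 0 < i ∧ x ∈ 𝒜 i}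

/-- The degree-zero piece is exactly `k`. -/
def ZeroPieceIsBase (𝒜 : ℕ → Submodule k R) : Prop :=
  ∀ x ∈ 𝒜 0, ∃ c : k, c • (1 : R) = x

/-- The Frobenius power `I^{[q]}`, generated by the `q`-th powers of the elements of `I`. -/
def frobPow {R : Type} [CommRing R] (I : Ideal R) (q : ℕ) : Ideal R :=
  Ideal.span ((fun x => x ^ q) '' (I : Set R))

/-- The `k`-dimension of the degree-`n` graded piece of the socle `(J : m)/J` of `R/J`. -/
noncomputable def socCount (𝒜 : ℕ → Submodule k R) (J : Ideal R) (n : ℕ) : ℕ :=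
  Module.finrank k ((Submodule.restrictScalars k (J.colon (irrel 𝒜)) ⊓ 𝒜 n) : Submodule k R) -
    Module.finrank k ((Submodule.restrictScalars k J ⊓ 𝒜 n) : Submodule k R)

/-- The socle degrees of `R/J` are `d 0 ≤ … ≤ d (ℓ-1)`, as a multiset. -/
def HasSocleDegrees (𝒜 : ℕ → Submodule k R) (J : Ideal R) {ℓ : ℕ} (d : Fin ℓ → ℕ) : Prop :=
  Monotone d ∧ ∀ n : ℕ, socCount 𝒜 J n = (univ.filter fun i => d i = n).card

/-- The Hilbert series of `R/J`. -/
noncomputable def hilbQ (𝒜 : ℕ → Submodule k R) (J : Ideal R) : PowerSeries ℤ :=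
  PowerSeries.mk fun n =>
    (Module.finrank k ((𝒜 n : Submodule k R)) : ℤ) -
      (Module.finrank k ((Submodule.restrictScalars k J ⊓ 𝒜 n) : Submodule k R) : ℤ)

/-- `a` is the `a`-invariant of `R/J`: for a Cohen-Macaulay graded quotient this is
the degree of the Hilbert series of `R/J` as a rational function, which agrees with the
Goto-Watanabe `a`-invariant defined via graded local cohomology. -/
def IsAInv (𝒜 : ℕ → Submodule k R) (J : Ideal R) (a : ℤ) : Prop :=
  ∃ num den : Polynomial ℤ, den ≠ 0 ∧
    (den : PowerSeries ℤ) * hilbQ 𝒜 J = (num : PowerSeries ℤ) ∧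
    a = (num.natDegree : ℤ) - den.natDegree

/-- `R` is F-pure: if `x ∉ J` then `x^q ∉ J^{[q]}` for all `q = p^e`. -/
def IsFPureRing (R : Type) [CommRing R] (p : ℕ) : Prop :=
  ∀ (J : Ideal R) (x : R), x ∉ J → ∀ e : ℕ, x ^ p ^ e ∉ frobPow J (p ^ e)

/-- A graded `k`-algebra is Cohen-Macaulay iff some homogeneous system of parameters is a
regular sequence. -/
def IsCMGraded (𝒜 : ℕ → Submodule k R) : Prop :=
  ∃ xs : List R, RingTheory.Sequence.IsRegular R xs ∧
    (∀ x ∈ xs, ∃ i, 0 < i ∧ x ∈ 𝒜 i) ∧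
    (Ideal.span {x | x ∈ xs}).radical = irrel 𝒜

/-- A graded `k`-algebra is Gorenstein iff some homogeneous system of parameters is a
regular sequence and the (artinian) quotient by it has one-dimensional socle. -/
def IsGorensteinGraded (𝒜 : ℕ → Submodule k R) : Prop :=
  ∃ xs : List R, RingTheory.Sequence.IsRegular R xs ∧
    (∀ x ∈ xs, ∃ i, 0 < i ∧ x ∈ 𝒜 i) ∧
    (Ideal.span {x | x ∈ xs}).radical = irrel 𝒜 ∧
    ∃ δ : ℕ, socCount 𝒜 (Ideal.span {x | x ∈ xs}) δ = 1 ∧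
      ∀ n : ℕ, n ≠ δ → socCount 𝒜 (Ideal.span {x | x ∈ xs}) n = 0

/-- `x 0, …, x (ℓ-1)` is a minimal generating set for the submodule `N`. -/
def IsMinGenSet {R M : Type} [CommRing R] [AddCommGroup M] [Module R M] {ℓ : ℕ}
    (x : Fin ℓ → M) (N : Submodule R M) : Prop :=
  Submodule.span R (Set.range x) = N ∧ ∀ i, x i ∉ Submodule.span R (x '' {j | j ≠ i})

/-- `Tor_n^R(M, N)`. -/
noncomputable def TorM (R : Type) [CommRing R] (n : ℕ) (M N : ModuleCat R) : ModuleCat R :=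
  ((Tor (ModuleCat R) n).obj M).obj N

/-- `R` viewed as a module over itself via the `e`-th iterate of the Frobenius
endomorphism, i.e. `^{φ_R^e}R`. -/
noncomputable def frobMod (R : Type) [CommRing R] (p : ℕ) [ExpChar R p] (e : ℕ) : ModuleCat R :=
  (ModuleCat.restrictScalars (iterateFrobenius R p e)).obj (ModuleCat.of R R)

/-- `M` has finite projective dimension over the graded algebra `R`: over a Noetherian
graded algebra with `R₀ = k` this is equivalent to the eventual vanishing of
`Tor_n^R(M, R/m)`, `m` the irrelevant maximal ideal. -/
def HasFinProjDim (𝒜 : ℕ → Submodule k R) (M : ModuleCat R) : Prop :=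
  ∃ n : ℕ, ∀ m : ℕ, n ≤ m → Subsingleton (TorM R m M (ModuleCat.of R (R ⧸ irrel 𝒜)))

/-- The degree-`n` graded piece of the twisted graded free module `⊕_j R(-b j)`. -/
def freePiece (𝒬 : ℕ → Submodule k R) {m : ℕ} (b : Fin m → ℕ) (n : ℤ) :
    Submodule k (Fin m → R) :=
  Submodule.pi Set.univ fun j =>
    if 0 ≤ n - (b j : ℤ) then 𝒬 (n - (b j : ℤ)).toNat else ⊥

/-- The data `(r, b, A)` is a minimal homogeneous free resolution of `R/J` of length `c`:
the `i`-th free module is `⊕_{j < r i} R(-b i j)`, and the differentials are given by the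
homogeneous matrices `A i`, with entries in the irrelevant maximal ideal (minimality). -/
def IsMinGradedFreeResolution (𝒜 : ℕ → Submodule k R) (J : Ideal R) (c : ℕ)
    (r : ℕ → ℕ) (b : (i : ℕ) → Fin (r i) → ℕ)
    (A : (i : ℕ) → Matrix (Fin (r i)) (Fin (r (i + 1))) R) : Prop :=
  r 0 = 1 ∧ (∀ j, b 0 j = 0) ∧ (∀ i, c < i → r i = 0) ∧ 0 < r c ∧
    (∀ i j l, A i j l ∈ 𝒜 (b (i + 1) l - b i j) ∧ (b (i + 1) l < b i j → A i j l = 0)) ∧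
    (∀ i j l, A i j l ∈ irrel 𝒜) ∧
    (∀ i, Function.Exact (Matrix.mulVecLin (A (i + 1))) (Matrix.mulVecLin (A i))) ∧
    Function.Exact (Matrix.mulVecLin (A 0))
      ((J.mkQ).comp (∑ j : Fin (r 0), LinearMap.proj j))

end Prelim

section Aux
variable {R : Type} [CommRing R]

/-- `a` is a nonzerodivisor modulo `I`. -/
def RegOn (I : Ideal R) (a : R) : Prop := ∀ x, a * x ∈ I → x ∈ I

/-- `l` is a weakly regular sequence modulo `I`. -/
def WReg : Ideal R → List R → Prop
  | _, [] => True
  | I, a :: l => RegOn I a ∧ WReg (I ⊔ Ideal.span {a}) l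

lemma mem_sup_span {I : Ideal R} {a x : R} :
    x ∈ I ⊔ Ideal.span {a} ↔ ∃ r, x - a * r ∈ I := by
  rw [Submodule.mem_sup]
  constructor
  · rintro ⟨y, hy, z, hz, rfl⟩
    obtain ⟨r, rfl⟩ := Ideal.mem_span_singleton'.1 hz
    exact ⟨r, by convert hy using 1; ring⟩
  · rintro ⟨r, hr⟩
    exact ⟨_, hr, a * r, Ideal.mem_span_singleton'.2 ⟨r, by ring⟩, by ring⟩

lemma RegOn.pow {I : Ideal R} {a : R} (h : RegOn I a) (n : ℕ) : RegOn I (a ^ n) := by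
  induction n with
  | zero => intro x hx; simpa using hx
  | succ n ih =>
    intro x hx
    apply h; apply ih
    convert hx using 1; ring

lemma RegOn.swap {I : Ideal R} {a g : R} (ha : RegOn I a)
    (hg : RegOn (I ⊔ Ideal.span {a}) g) : RegOn (I ⊔ Ideal.span {g}) a := by
  intro r hr
  obtain ⟨s, hs⟩ := mem_sup_span.1 hr
  have h1 : s ∈ I ⊔ Ideal.span {a} := by
    apply hg
    refine mem_sup_span.2 ⟨r, ?_⟩
    have := I.neg_mem hs
    convert this using 1; ring
  obtain ⟨t, ht⟩ := mem_sup_span.1 h1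
  refine mem_sup_span.2 ⟨t, ha _ ?_⟩
  have := I.add_mem hs (I.mul_mem_left g ht)
  convert this using 1; ring

lemma RegOn.mod_pow {I : Ideal R} {a g : R} (ha : RegOn I a)
    (hg : RegOn (I ⊔ Ideal.span {a}) g) (n : ℕ) : RegOn (I ⊔ Ideal.span {a ^ n}) g := by
  induction n with
  | zero => intro x _; simp
  | succ n ih =>
    intro x hx
    obtain ⟨r, hr⟩ := mem_sup_span.1 hx
    obtain ⟨s, hs⟩ := mem_sup_span.1 (ih x (mem_sup_span.2 ⟨a * r, by convert hr using 1; ring⟩))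
    have h1 : g * s - a * r ∈ I := by
      apply ha.pow n
      have := I.sub_mem hr (I.mul_mem_left g hs)
      convert this using 1; ring
    obtain ⟨t, ht⟩ := mem_sup_span.1 (hg s (mem_sup_span.2 ⟨r, h1⟩))
    refine mem_sup_span.2 ⟨t, ?_⟩
    have := I.add_mem hs (I.mul_mem_left (a ^ n) ht)
    convert this using 1; ring

lemma WReg.mod_pow {l : List R} : ∀ {I : Ideal R} {a : R}, WReg I (a :: l) → ∀ n : ℕ,
    WReg (I ⊔ Ideal.span {a ^ n}) l := by
  induction l with
  | nil => intros; trivial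
  | cons g l ih =>
    rintro I a ⟨ha, hg, hl⟩ n
    refine ⟨ha.mod_pow hg n, ?_⟩
    rw [sup_right_comm] at hl ⊢
    exact ih ⟨ha.swap hg, hl⟩ n

lemma WReg.regOn_last {l : List R} : ∀ {I : Ideal R} {a : R}, WReg I (a :: l) →
    RegOn (I ⊔ Ideal.ofList l) a := by
  induction l with
  | nil => rintro I a ⟨h, -⟩; simpa using h
  | cons g l ih =>
    rintro I a ⟨ha, hg, hl⟩
    rw [sup_right_comm] at hl
    have := ih (I := I ⊔ Ideal.span {g}) ⟨ha.swap hg, hl⟩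
    rwa [Ideal.ofList_cons, ← sup_assoc]

lemma WReg.colon_prod {m : ℕ} {l : List R} : ∀ {I : Ideal R}, WReg I l → ∀ r : R,
    r * l.prod ^ m ∈ I ⊔ Ideal.ofList (l.map (· ^ (m + 1))) → r ∈ I ⊔ Ideal.ofList l := by
  induction l with
  | nil => intro I _ r hr; simpa using hr
  | cons a l ih =>
    intro I h r hr
    rw [List.map_cons, Ideal.ofList_cons, ← sup_assoc] at hr
    have h1 := ih (h.mod_pow (m + 1)) (r * a ^ m) (by
      convert hr using 1; rw [List.prod_cons]; ring)
    rw [sup_right_comm] at h1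
    obtain ⟨s, hs⟩ := mem_sup_span.1 h1
    rw [Ideal.ofList_cons, sup_comm (Ideal.span _), ← sup_assoc]
    refine mem_sup_span.2 ⟨s, h.regOn_last.pow m _ ?_⟩
    convert hs using 1; ring

lemma mul_prod_pow_mem {m : ℕ} (l : List R) {r : R} (hr : r ∈ Ideal.ofList l) :
    r * l.prod ^ m ∈ Ideal.ofList (l.map (· ^ (m + 1))) := by
  refine Submodule.span_induction (p := fun r _ => r * l.prod ^ m ∈
    Ideal.ofList (l.map (· ^ (m + 1)))) ?_ ?_ ?_ ?_ hr
  · intro x hx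
    obtain ⟨t, ht⟩ := List.dvd_prod (show x ∈ l from hx)
    have : x ^ (m + 1) ∈ Ideal.ofList (l.map (· ^ (m + 1))) :=
      Ideal.subset_span (List.mem_map.2 ⟨x, hx, rfl⟩)
    have := Ideal.mul_mem_left _ (t ^ m) this
    convert this using 1; rw [ht]; ring
  · simp
  · intro x y _ _ hx hy
    rw [add_mul]; exact Ideal.add_mem _ hx hy
  · intro a x _ hx
    rw [smul_eq_mul, mul_assoc]; exact Ideal.mul_mem_left _ _ hx

lemma WReg.colon {m : ℕ} {l : List R} : ∀ {I : Ideal R}, WReg I l → ∀ x : R,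
    (∀ a ∈ l, x * a ∈ I ⊔ Ideal.ofList (l.map (· ^ (m + 1)))) →
    x ∈ (I ⊔ Ideal.ofList (l.map (· ^ (m + 1)))) ⊔ Ideal.span {l.prod ^ m} := by
  induction l with
  | nil => intro I _ x _; simp
  | cons a l ih =>
    intro I h x hx
    rw [List.map_cons, Ideal.ofList_cons, ← sup_assoc] at hx ⊢
    obtain ⟨r, hr⟩ := mem_sup_span.1 (ih (h.mod_pow (m + 1)) x
      (fun b hb => hx b (List.mem_cons_of_mem _ hb)))
    have h1 := (h.mod_pow (m + 1)).colon_prod (r * a) (m := m) (by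
      have := Ideal.sub_mem _ (hx a List.mem_cons_self) (Ideal.mul_mem_left _ a hr)
      convert this using 1; ring)
    rw [sup_right_comm] at h1
    obtain ⟨s, hs⟩ := mem_sup_span.1 h1
    have h2 : r - a ^ m * s ∈ I ⊔ Ideal.ofList l := by
      apply h.regOn_last
      convert hs using 1; ring
    obtain ⟨i, hi, j, hj, hij⟩ := Submodule.mem_sup.1 h2
    have h3 : i * l.prod ^ m + j * l.prod ^ m ∈
        I ⊔ Ideal.span {a ^ (m + 1)} ⊔ Ideal.ofList (l.map (· ^ (m + 1))) :=
      Ideal.add_mem _ (Ideal.mem_sup_left (Ideal.mem_sup_left (Ideal.mul_mem_right _ _ hi)))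
        (Ideal.mem_sup_right (mul_prod_pow_mem l hj))
    refine mem_sup_span.2 ⟨s, ?_⟩
    have := Ideal.add_mem _ hr h3
    convert this using 1
    rw [List.prod_cons, ← add_mul, hij]; ring

lemma wReg_of {l : List R} : ∀ {I : Ideal R},
    (∀ i (h : i < l.length), RegOn (I ⊔ Ideal.ofList (l.take i)) l[i]) → WReg I l := by
  induction l with
  | nil => intros; trivial
  | cons a l ih =>
    intro I h
    refine ⟨by
      have h0 : RegOn (I ⊔ Ideal.ofList ((a :: l).take 0)) a := h 0 (by simp)
      simpa using h0, ih fun i hi => ?_⟩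
    have := h (i + 1) (by simpa using hi)
    simpa [sup_assoc] using this

lemma wReg_of_isWeaklyRegular {l : List R}
    (h : RingTheory.Sequence.IsWeaklyRegular R l) : WReg ⊥ l := by
  refine wReg_of fun i hi x hx => ?_
  have h1 := h.regular_mod_prev i hi
  rw [bot_sup_eq] at hx ⊢
  have e : (Ideal.ofList (l.take i) • ⊤ : Submodule R R) = Ideal.ofList (l.take i) := by
    simp
  rw [e] at h1
  have := @h1 (Submodule.Quotient.mk x) (Submodule.Quotient.mk 0) (by
    simp only [← Submodule.Quotient.mk_smul]
    rw [Submodule.Quotient.eq]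
    simpa using hx)
  rw [Submodule.Quotient.eq] at this
  simpa using this

end Aux

/-- **Linkage of Frobenius powers of a complete intersection.** If `C` is generated by a
regular sequence `f 0, …, f (c-1)` in a polynomial ring over a field of characteristic `p`,
and `q = p^e`, then `C^{[q]} : C = (y) + C^{[q]}` where `y = (f 0 ⋯ f (c-1))^(q-1)`. -/
theorem socle_degrees_stmt19
    {k : Type} [Field k] (p : ℕ) [Fact p.Prime] [CharP k p]
    {σ : Type} [Fintype σ] (e : ℕ) (q : ℕ) (hq : q = p ^ e)
    (c : ℕ) (f : Fin c → MvPolynomial σ k)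
    (hreg : RingTheory.Sequence.IsRegular (MvPolynomial σ k) (List.ofFn f))
    (C : Ideal (MvPolynomial σ k)) (hC : C = Ideal.span (Set.range f)) :
    (frobPow C q).colon C =
      Ideal.span {(∏ i, f i) ^ (q - 1)} + frobPow C q := by
  obtain ⟨m, hm⟩ : ∃ m, q = m + 1 :=
    ⟨q - 1, by
      have : 0 < q := by rw [hq]; exact pow_pos (Fact.out : p.Prime).pos e
      omega⟩
  have hC' : C = Ideal.ofList (List.ofFn f) := by
    rw [hC]; unfold Ideal.ofList; congr 1; ext x; simp [List.mem_ofFn]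
  have : ExpChar (MvPolynomial σ k) p := ExpChar.prime (Fact.out : p.Prime)
  have hF : frobPow C q = Ideal.ofList ((List.ofFn f).map (· ^ (m + 1))) := by
    have h1 : frobPow C q = Ideal.map (iterateFrobenius (MvPolynomial σ k) p e) C := by
      unfold frobPow Ideal.map
      congr 1; ext x; simp [iterateFrobenius_def, hq]
    rw [h1, hC', Ideal.map_ofList, ← hm, hq]
    rfl
  have hprod : (∏ i, f i) ^ (q - 1) = (List.ofFn f).prod ^ m := by
    rw [List.prod_ofFn, hm]; rfl
  have hW := wReg_of_isWeaklyRegular hreg.toIsWeaklyRegular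
  rw [hprod, hF, Submodule.add_eq_sup, sup_comm]
  apply le_antisymm
  · intro x hx
    rw [Submodule.mem_colon] at hx
    have := hW.colon (m := m) x (fun a ha => by
      rw [bot_sup_eq]
      exact hx a (by rw [hC']; exact Ideal.subset_span ha))
    rwa [bot_sup_eq] at this
  · refine sup_le ?_ ?_
    · intro x hx
      rw [Submodule.mem_colon]
      intro a _
      exact Ideal.mul_mem_right _ _ hx
    · rw [Ideal.span_singleton_le_iff_mem, Submodule.mem_colon]
      intro a ha
      rw [hC'] at ha
      rw [smul_eq_mul, mul_comm]
      exact mul_prod_pow_mem _ ha
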